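/- arXiv:1607.07591 — 2 statements merged into one kernel-verified Lean document; each statement's English description precedes it below -/
import Mathlib

section
/- Let 0 < a and γ > 0, and let α be a differentiable function with values in (0,1). Define x(t) = (ln(t/a))^γ for t ≥ a (with x(a)=0). Then for every t > a, the left Caputo–Hadamard fractional derivative of variable order type 3 of x at t equals Γ(γ+1)/Γ(γ+1−α(t)) · (ln(t/a))^{γ−α(t)} − (t·α'(t)·Γ(γ+1)/Γ(γ+2−α(t))) · (ln(t/a))^{γ+1−α(t)} · [ln(ln(t/a)) − ψ(γ+2−α(t))]. -/
/-- The digamma function `ψ(x) = Γ'(x)/Γ(x)`. -/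
noncomputable def digamma (x : ℝ) : ℝ := deriv Real.Gamma x / Real.Gamma x

/-- The left Caputo–Hadamard fractional derivative of variable order `α(t)`, type 3. -/
noncomputable def CHD3 (a : ℝ) (α x : ℝ → ℝ) (t : ℝ) : ℝ :=
  t * deriv (fun s : ℝ => (1 / Real.Gamma (1 - α s)) *
    ∫ τ in a..s, (Real.log (s / τ)) ^ (-(α s)) * (x τ - x a) / τ) t

theorem aux_beta (L γ α : ℝ) (hL : 0 < L) (hγ : 0 < γ) (hα : α < 1) :
    ∫ u in (0:ℝ)..L, u ^ γ * (L - u) ^ (-α) =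
      L ^ (γ + 1 - α) * (Real.Gamma (γ + 1) * Real.Gamma (1 - α) / Real.Gamma (γ + 2 - α)) := by
  have h := Complex.betaIntegral_scaled ((γ + 1 : ℝ) : ℂ) ((1 - α : ℝ) : ℂ) hL
  rw [Complex.betaIntegral_eq_Gamma_mul_div _ _ (by simp; linarith) (by simp; linarith)] at h
  have e1 : (∫ x in (0:ℝ)..L, (x : ℂ) ^ (((γ + 1 : ℝ) : ℂ) - 1) *
      ((L : ℂ) - x) ^ (((1 - α : ℝ) : ℂ) - 1)) =
      ∫ x in (0:ℝ)..L, ((x ^ γ * (L - x) ^ (-α) : ℝ) : ℂ) := by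
    apply intervalIntegral.integral_congr
    intro x hx
    rw [Set.uIcc_of_le hL.le] at hx
    simp only
    rw [Complex.ofReal_mul, Complex.ofReal_cpow hx.1, Complex.ofReal_cpow (by linarith [hx.2])]
    push_cast
    congr 2 <;> ring
  rw [e1, intervalIntegral.integral_ofReal, ← Complex.ofReal_add, ← Complex.ofReal_one,
    ← Complex.ofReal_sub, ← Complex.ofReal_cpow hL.le, Complex.Gamma_ofReal,
    Complex.Gamma_ofReal, Complex.Gamma_ofReal] at h
  norm_cast at h
  rw [h, show γ + 1 + (1 - α) = γ + 2 - α by ring, show γ + 2 - α - 1 = γ + 1 - α by ring]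

theorem aux_image (a s : ℝ) (ha : 0 < a) (hs : a < s) :
    (fun τ => Real.log (τ / a)) '' Set.Ioo a s = Set.Ioo 0 (Real.log (s / a)) := by
  ext u
  constructor
  · rintro ⟨τ, ⟨h1, h2⟩, rfl⟩
    refine ⟨Real.log_pos ((one_lt_div ha).2 h1), ?_⟩
    apply Real.log_lt_log (div_pos (ha.trans h1) ha)
    gcongr
  · rintro ⟨h1, h2⟩
    refine ⟨a * Real.exp u, ⟨?_, ?_⟩, ?_⟩
    · have := Real.one_lt_exp_iff.2 h1
      nlinarith
    · rw [Real.lt_log_iff_exp_lt (div_pos (ha.trans hs) ha), lt_div_iff₀ ha] at h2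
      linarith
    · simp only
      rw [mul_div_cancel_left₀ _ ha.ne', Real.log_exp]

theorem aux_int (a γ α s : ℝ) (ha : 0 < a) (hγ : 0 < γ) (hα : α < 1) (hs : a < s) :
    ∫ τ in a..s, (Real.log (s / τ)) ^ (-α) *
      ((Real.log (τ / a)) ^ γ - (Real.log (a / a)) ^ γ) / τ =
    (Real.log (s / a)) ^ (γ + 1 - α) *
      (Real.Gamma (γ + 1) * Real.Gamma (1 - α) / Real.Gamma (γ + 2 - α)) := by
  have hL : 0 < Real.log (s / a) := Real.log_pos ((one_lt_div ha).2 hs)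
  rw [← aux_beta _ γ α hL hγ hα, intervalIntegral.integral_of_le hs.le,
    intervalIntegral.integral_of_le hL.le, MeasureTheory.integral_Ioc_eq_integral_Ioo,
    MeasureTheory.integral_Ioc_eq_integral_Ioo, ← aux_image a s ha hs,
    MeasureTheory.integral_image_eq_integral_abs_deriv_smul (f' := fun τ => τ⁻¹)
      measurableSet_Ioo]
  · apply MeasureTheory.setIntegral_congr_fun measurableSet_Ioo
    rintro τ ⟨h1, h2⟩
    have hτ : 0 < τ := ha.trans h1
    have hs0 : 0 < s := ha.trans hs
    simp only
    rw [div_self ha.ne', Real.log_one, Real.zero_rpow hγ.ne', abs_of_pos (inv_pos.2 hτ),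
      show Real.log (s / a) - Real.log (τ / a) = Real.log (s / τ) by
        rw [Real.log_div hs0.ne' ha.ne', Real.log_div hτ.ne' ha.ne',
          Real.log_div hs0.ne' hτ.ne']; ring]
    simp only [smul_eq_mul]
    ring
  · rintro τ ⟨h1, h2⟩
    have hτ : 0 < τ := ha.trans h1
    have := ((hasDerivAt_id τ).div_const a).log (div_pos hτ ha).ne'
    refine HasDerivAt.hasDerivWithinAt ?_
    convert! this using 1
    simp only [id]
    field_simp
  · intro x hx y hy h
    have hx0 := ha.trans hx.1
    have hy0 := ha.trans hy.1
    have := Real.log_injOn_pos (Set.mem_Ioi.2 (div_pos hx0 ha)) (Set.mem_Ioi.2 (div_pos hy0 ha)) h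
    field_simp at this
    exact this

/-- the value of the left Caputo–Hadamard derivative of variable order,
type 3, of `x(t) = (ln(t/a))^γ`. -/
theorem caputoHadamard_left_type3_log_rpow
    (a γ : ℝ) (ha : 0 < a) (hγ : 0 < γ) (α : ℝ → ℝ)
    (hα : ∀ s, α s ∈ Set.Ioo (0 : ℝ) 1) (hαd : Differentiable ℝ α)
    (t : ℝ) (ht : a < t) :
    CHD3 a α (fun s : ℝ => (Real.log (s / a)) ^ γ) t
      = Real.Gamma (γ + 1) / Real.Gamma (γ + 1 - α t) *
          (Real.log (t / a)) ^ (γ - α t)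
        - (t * deriv α t * Real.Gamma (γ + 1) / Real.Gamma (γ + 2 - α t)) *
            (Real.log (t / a)) ^ (γ + 1 - α t) *
            (Real.log (Real.log (t / a)) - digamma (γ + 2 - α t)) := by
  unfold CHD3 digamma
  have ht0 : 0 < t := ha.trans ht
  have hL : 0 < Real.log (t / a) := Real.log_pos ((one_lt_div ha).2 ht)
  have hE : (fun s : ℝ => (1 / Real.Gamma (1 - α s)) *
      ∫ τ in a..s, (Real.log (s / τ)) ^ (-(α s)) *
        ((Real.log (τ / a)) ^ γ - (Real.log (a / a)) ^ γ) / τ) =ᶠ[nhds t]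
      fun s => Real.Gamma (γ + 1) *
        ((Real.log (s / a)) ^ (γ + 1 - α s) / Real.Gamma (γ + 2 - α s)) := by
    filter_upwards [lt_mem_nhds ht] with s hs
    rw [aux_int a γ (α s) s ha hγ (hα s).2 hs]
    have h1 : Real.Gamma (1 - α s) ≠ 0 := (Real.Gamma_pos_of_pos (by linarith [(hα s).2])).ne'
    field_simp
  simp only
  rw [hE.deriv_eq]
  have hp : 0 < γ + 1 - α t := by linarith [(hα t).2]
  have hd := (hαd t).hasDerivAt
  have hlog := ((hasDerivAt_id t).div_const a).log (div_pos ht0 ha).ne'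
  have hpow := hlog.rpow (hd.const_sub (γ + 1)) hL
  have hG : HasDerivAt Real.Gamma (deriv Real.Gamma (γ + 2 - α t)) (γ + 2 - α t) :=
    (Real.differentiableAt_Gamma (fun m => by
      have : (0:ℝ) ≤ m := m.cast_nonneg
      linarith)).hasDerivAt
  have hG2 := hG.comp t (hd.const_sub (γ + 2))
  have hGr : Real.Gamma (γ + 2 - α t) = (γ + 1 - α t) * Real.Gamma (γ + 1 - α t) := by
    rw [← Real.Gamma_add_one hp.ne']; congr 1; ring
  have hG0 : Real.Gamma (γ + 1 - α t) ≠ 0 := (Real.Gamma_pos_of_pos hp).ne'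
  have hG1 : Real.Gamma (γ + 2 - α t) ≠ 0 := (Real.Gamma_pos_of_pos (by linarith)).ne'
  have hfin := (hpow.div hG2 hG1).const_mul (Real.Gamma (γ + 1))
  have hfin' := hfin.deriv
  simp only [Function.comp_def, id] at hfin'
  refine (congrArg (t * ·) hfin').trans ?_
  rw [show γ + 1 - α t - 1 = γ - α t by ring]
  generalize deriv Real.Gamma (γ + 2 - α t) = G'
  rw [hGr]
  generalize Real.Gamma (γ + 1 - α t) = G at *
  generalize Real.log (t / a) ^ (γ - α t) = P
  generalize Real.log (t / a) ^ (γ + 1 - α t) = Q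
  generalize γ + 1 - α t = p at *
  have := hp.ne'
  field_simp
  ring
end

section
/- Let 0 < a < b, let α : [a,b] → (0,1) be differentiable, and let x : [a,b] → ℝ be continuously differentiable. Then for every t ∈ [a,b), (D₃ᵇx)(t) = (D₂ᵇx)(t) − (t·α'(t)·ψ(1−α(t))/Γ(1−α(t))) ∫_t^b (ln(τ/t))^{−α(t)} (x(τ)−x(b))/τ dτ. -/
/-- The right Caputo–Hadamard fractional derivative of variable order `α(t)`, type 2. -/
noncomputable def CHD2r (b : ℝ) (α x : ℝ → ℝ) (t : ℝ) : ℝ :=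
  (-t / Real.Gamma (1 - α t)) *
    deriv (fun s : ℝ => ∫ τ in s..b, (Real.log (τ / s)) ^ (-(α s)) * (x τ - x b) / τ) t

/-- The right Caputo–Hadamard fractional derivative of variable order `α(t)`, type 3. -/
noncomputable def CHD3r (b : ℝ) (α x : ℝ → ℝ) (t : ℝ) : ℝ :=
  -t * deriv (fun s : ℝ => (1 / Real.Gamma (1 - α s)) *
    ∫ τ in s..b, (Real.log (τ / s)) ^ (-(α s)) * (x τ - x b) / τ) t

open MeasureTheory Set Filter Topology

theorem aux_diff (z : ℝ → ℝ) (hz : ContDiff ℝ 1 z) (B c σ₀ β₀ : ℝ) (hβ : β₀ < 1) :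
    DifferentiableAt ℝ (fun p : ℝ × ℝ =>
      ∫ v in Ioo (0 : ℝ) 1, v ^ (-p.2) * (z ((1 - v) * p.1 + v * B) - c)) (σ₀, β₀) := by
  have hzc : Continuous z := hz.continuous
  have hzd : Continuous (deriv z) := hz.continuous_deriv le_rfl
  have hzdiff : Differentiable ℝ z := hz.differentiable one_ne_zero
  obtain ⟨ε, hε, hε3⟩ : ∃ ε : ℝ, 0 < ε ∧ β₀ + 2 * ε < 1 :=
    ⟨(1 - β₀) / 3, by linarith, by linarith⟩
  set R := |σ₀| + |B| + 1 with hR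
  obtain ⟨M₁, hM₁⟩ := (isCompact_Icc (a := -R) (b := R)).exists_bound_of_continuousOn
    (f := fun u => z u - c) (by fun_prop)
  obtain ⟨M₂, hM₂⟩ := (isCompact_Icc (a := -R) (b := R)).exists_bound_of_continuousOn
    (f := deriv z) hzd.continuousOn
  simp only [Real.norm_eq_abs] at hM₁ hM₂
  have hmem : ∀ v ∈ Ioo (0 : ℝ) 1, ∀ σ ∈ Metric.ball σ₀ 1, (1 - v) * σ + v * B ∈ Icc (-R) R := by
    intro v hv σ hσ
    rw [Metric.mem_ball, Real.dist_eq] at hσ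
    have h1 : |σ| ≤ |σ₀| + 1 := by
      have := abs_sub_abs_le_abs_sub σ σ₀
      linarith
    rw [mem_Icc, ← abs_le]
    calc |(1 - v) * σ + v * B| ≤ |(1 - v) * σ| + |v * B| := abs_add_le _ _
      _ = (1 - v) * |σ| + v * |B| := by
        rw [abs_mul, abs_mul, abs_of_pos hv.1, abs_of_pos (by linarith [hv.2] : 0 < 1 - v)]
      _ ≤ 1 * |σ| + 1 * |B| := by
        have := hv.1; have := hv.2
        gcongr <;> linarith
      _ ≤ R := by rw [hR]; linarith
  let L₁ : ℝ × ℝ →L[ℝ] ℝ := ContinuousLinearMap.fst ℝ ℝ ℝ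
  let L₂ : ℝ × ℝ →L[ℝ] ℝ := ContinuousLinearMap.snd ℝ ℝ ℝ
  let F' : ℝ × ℝ → ℝ → (ℝ × ℝ →L[ℝ] ℝ) := fun p v =>
    (v ^ (-p.2)) • ((deriv z ((1 - v) * p.1 + v * B)) • ((1 - v) • L₁)) +
      (z ((1 - v) * p.1 + v * B) - c) • ((v ^ (-p.2) * Real.log v) • (-L₂))
  have hint : ∀ r : ℝ, r < 1 → ∀ C : ℝ,
      Integrable (fun v : ℝ => C * v ^ (-r)) (volume.restrict (Ioo (0 : ℝ) 1)) := by
    intro r hr C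
    exact ((intervalIntegral.integrableOn_Ioo_rpow_iff one_pos).2 (by linarith)).const_mul C
  have hmeas : ∀ p : ℝ × ℝ, AEStronglyMeasurable
      (fun v : ℝ => v ^ (-p.2) * (z ((1 - v) * p.1 + v * B) - c))
      (volume.restrict (Ioo (0 : ℝ) 1)) := by
    intro p
    have h1 : Continuous (fun v : ℝ => z ((1 - v) * p.1 + v * B) - c) := by fun_prop
    exact ((measurable_id.pow_const _).mul h1.measurable).aestronglyMeasurable
  refine (hasFDerivAt_integral_of_dominated_of_fderiv_le (F' := F')
    (s := Metric.ball σ₀ 1 ×ˢ Metric.ball β₀ ε)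
    (bound := fun v => (M₂ + M₁ * (1 / ε)) * v ^ (-(β₀ + 2 * ε))) ?_ ?_ ?_ ?_ ?_
    (hint _ hε3 _) ?_).differentiableAt
  · exact prod_mem_nhds (Metric.ball_mem_nhds _ one_pos) (Metric.ball_mem_nhds _ hε)
  · exact Eventually.of_forall hmeas
  · refine (hint β₀ hβ M₁).mono' (hmeas _) ?_
    refine ae_restrict_of_forall_mem measurableSet_Ioo fun v hv => ?_
    have := hM₁ _ (hmem v hv σ₀ (Metric.mem_ball_self one_pos))
    rw [Real.norm_eq_abs, abs_mul, abs_of_nonneg (Real.rpow_nonneg hv.1.le _), mul_comm]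
    exact mul_le_mul_of_nonneg_right this (Real.rpow_nonneg hv.1.le _)
  · have h1 : Continuous (fun v : ℝ => z ((1 - v) * σ₀ + v * B) - c) := by fun_prop
    have h2 : Continuous (fun v : ℝ => (deriv z ((1 - v) * σ₀ + v * B)) • ((1 - v) • L₁)) := by
      fun_prop
    have h3 : Measurable (fun v : ℝ => v ^ (-β₀)) := measurable_id.pow_const _
    have h4 : Measurable (fun v : ℝ => v ^ (-β₀) * Real.log v) := h3.mul Real.measurable_log
    exact ((h3.aestronglyMeasurable.smul h2.aestronglyMeasurable).add
      (h1.aestronglyMeasurable.smul (h4.aestronglyMeasurable.smul_const (-L₂))))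
  · refine ae_restrict_of_forall_mem measurableSet_Ioo fun v hv p hp => ?_
    have hm := hmem v hv p.1 hp.1
    have b1 := hM₁ _ hm
    have b2 := hM₂ _ hm
    have hp2 : p.2 < β₀ + ε := by
      have := hp.2
      rw [Metric.mem_ball, Real.dist_eq, abs_lt] at this
      linarith
    have hL₁ : ‖L₁‖ ≤ 1 := ContinuousLinearMap.norm_fst_le _ _ _
    have hL₂ : ‖L₂‖ ≤ 1 := ContinuousLinearMap.norm_snd_le _ _ _
    have hv0 := hv.1
    have hv1 := hv.2
    have hM₁0 : 0 ≤ M₁ := (abs_nonneg _).trans b1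
    have hM₂0 : 0 ≤ M₂ := (abs_nonneg _).trans b2
    have e1 : v ^ (-p.2) ≤ v ^ (-(β₀ + 2 * ε)) :=
      Real.rpow_le_rpow_of_exponent_ge hv0 hv1.le (by linarith)
    have e2 : |v ^ (-p.2) * Real.log v| ≤ (1 / ε) * v ^ (-(β₀ + 2 * ε)) := by
      have h := (Real.abs_log_mul_self_rpow_lt v ε hv0 hv1.le hε).le
      have : v ^ (-p.2) * Real.log v = (Real.log v * v ^ ε) * v ^ (-p.2 - ε) := by
        rw [mul_assoc, ← Real.rpow_add hv0]
        ring_nf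
      rw [this, abs_mul, abs_of_nonneg (Real.rpow_nonneg hv0.le (-p.2 - ε))]
      have e3 : v ^ (-p.2 - ε) ≤ v ^ (-(β₀ + 2 * ε)) :=
        Real.rpow_le_rpow_of_exponent_ge hv0 hv1.le (by linarith)
      gcongr
    have hpos := Real.rpow_nonneg hv0.le (-(β₀ + 2 * ε))
    have hpos' := Real.rpow_nonneg hv0.le (-p.2)
    have n1 : ‖(v ^ (-p.2)) • ((deriv z ((1 - v) * p.1 + v * B)) • ((1 - v) • L₁))‖
        ≤ v ^ (-(β₀ + 2 * ε)) * (M₂ * (1 * 1)) := by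
      rw [norm_smul, norm_smul, norm_smul, Real.norm_eq_abs, Real.norm_eq_abs, Real.norm_eq_abs,
        abs_of_nonneg hpos', abs_of_pos (by linarith : 0 < 1 - v)]
      gcongr
      linarith
    have n2 : ‖(z ((1 - v) * p.1 + v * B) - c) • ((v ^ (-p.2) * Real.log v) • (-L₂))‖
        ≤ M₁ * ((1 / ε) * v ^ (-(β₀ + 2 * ε)) * 1) := by
      rw [norm_smul, norm_smul, norm_neg, Real.norm_eq_abs, Real.norm_eq_abs]
      gcongr
    calc _ ≤ _ := norm_add_le _ _
      _ ≤ _ := add_le_add n1 n2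
      _ = _ := by ring
  · refine ae_restrict_of_forall_mem measurableSet_Ioo fun v hv p hp => ?_
    have d1 : HasFDerivAt (fun q : ℝ × ℝ => q.1) L₁ p := hasFDerivAt_fst
    have d2 : HasFDerivAt (fun q : ℝ × ℝ => q.2) L₂ p := hasFDerivAt_snd
    have d3 : HasFDerivAt (fun q : ℝ × ℝ => (1 - v) * q.1 + v * B) ((1 - v) • L₁) p :=
      (d1.const_mul (1 - v)).add_const _
    have d4 := ((hzdiff ((1 - v) * p.1 + v * B)).hasDerivAt.comp_hasFDerivAt p d3).sub_const c
    have d5 : HasFDerivAt (fun q : ℝ × ℝ => v ^ (-q.2)) ((v ^ (-p.2) * Real.log v) • (-L₂)) p := by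
      have := (Real.hasStrictDerivAt_const_rpow hv.1 (-p.2)).hasDerivAt.comp_hasFDerivAt p d2.neg
      exact this
    exact d5.mul d4

theorem aux_subst (x : ℝ → ℝ) (s b β : ℝ) (hs : 0 < s) (hsb : s < b) :
    (∫ τ in s..b, (Real.log (τ / s)) ^ (-β) * (x τ - x b) / τ)
      = (Real.log b - Real.log s) ^ (1 - β) * ∫ v in Ioo (0 : ℝ) 1,
          v ^ (-β) * (x (Real.exp ((1 - v) * Real.log s + v * Real.log b)) - x b) := by
  have hb : 0 < b := hs.trans hsb
  set L := Real.log b - Real.log s with hL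
  have hL0 : 0 < L := sub_pos.2 (Real.log_lt_log hs hsb)
  set f : ℝ → ℝ := fun v => Real.exp ((1 - v) * Real.log s + v * Real.log b) with hf
  have hfm : ∀ v w : ℝ, v < w → f v < f w := by
    intro v w h
    apply Real.exp_lt_exp.2
    nlinarith
  have hf0 : f 0 = s := by simp [hf, Real.exp_log hs]
  have hf1 : f 1 = b := by simp [hf, Real.exp_log hb]
  have him : f '' Ioo 0 1 = Ioo s b := by
    ext τ
    constructor
    · rintro ⟨v, hv, rfl⟩
      exact ⟨hf0 ▸ hfm _ _ hv.1, by simpa only [hf1] using hfm _ _ hv.2⟩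
    · rintro ⟨h1, h2⟩
      have hτ := hs.trans h1
      refine ⟨(Real.log τ - Real.log s) / L, ⟨?_, ?_⟩, ?_⟩
      · exact div_pos (sub_pos.2 (Real.log_lt_log hs h1)) hL0
      · rw [div_lt_one hL0]
        have := Real.log_lt_log hτ h2
        linarith
      · have : (1 - (Real.log τ - Real.log s) / L) * Real.log s
            + (Real.log τ - Real.log s) / L * Real.log b = Real.log τ := by
          field_simp
          rw [hL]; ring
        simp only [hf]
        rw [this, Real.exp_log hτ]
  have hder : ∀ v ∈ Ioo (0 : ℝ) 1, HasDerivWithinAt f (f v * L) (Ioo 0 1) v := by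
    intro v _
    have h1 : HasDerivAt (fun v : ℝ => (1 - v) * Real.log s + v * Real.log b) L v := by
      have := (((hasDerivAt_id v).const_sub 1).mul_const (Real.log s)).add
        ((hasDerivAt_id v).mul_const (Real.log b))
      have e : -1 * Real.log s + 1 * Real.log b = L := by rw [hL]; ring
      rw [e] at this
      exact this
    exact h1.exp.hasDerivWithinAt
  rw [intervalIntegral.integral_of_le hsb.le, integral_Ioc_eq_integral_Ioo, ← him,
    integral_image_eq_integral_deriv_smul_of_monotoneOn measurableSet_Ioo hder
      (fun v _ w _ h => (StrictMono.monotone (fun v w h => hfm v w h)) h),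
    ← integral_const_mul]
  refine setIntegral_congr_fun measurableSet_Ioo fun v hv => ?_
  have hfv : 0 < f v := Real.exp_pos _
  have hlog : Real.log (f v / s) = L * v := by
    rw [Real.log_div hfv.ne' hs.ne']
    simp only [hf, Real.log_exp]
    rw [hL]; ring
  simp only [smul_eq_mul]
  rw [hlog, Real.mul_rpow hL0.le hv.1.le, show 1 - β = 1 + -β by ring, Real.rpow_add hL0,
    Real.rpow_one]
  change _ = _ * (_ * (x (f v) - x b))
  field_simp

theorem CHD3r_eq_CHD2r_sub
    (a b : ℝ) (ha : 0 < a) (hab : a < b) (α x : ℝ → ℝ)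
    (hα : ∀ t ∈ Set.Icc a b, α t ∈ Set.Ioo (0 : ℝ) 1)
    (hαd : ∀ t ∈ Set.Icc a b, DifferentiableAt ℝ α t)
    (hx : ContDiff ℝ 1 x)
    (t : ℝ) (ht : t ∈ Set.Ico a b) :
    CHD3r b α x t
      = CHD2r b α x t
        - (t * deriv α t * digamma (1 - α t) / Real.Gamma (1 - α t)) *
            ∫ τ in t..b, (Real.log (τ / t)) ^ (-(α t)) * (x τ - x b) / τ := by
  have ht0 : 0 < t := ha.trans_le ht.1
  have htI : t ∈ Set.Icc a b := ⟨ht.1, ht.2.le⟩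
  have hαt := hα t htI
  have hαd' := hαd t htI
  have hlog : DifferentiableAt ℝ Real.log t := Real.differentiableAt_log ht0.ne'
  have hI : DifferentiableAt ℝ
      (fun s : ℝ => ∫ τ in s..b, (Real.log (τ / s)) ^ (-(α s)) * (x τ - x b) / τ) t := by
    have hev : (fun s : ℝ => ∫ τ in s..b, (Real.log (τ / s)) ^ (-(α s)) * (x τ - x b) / τ)
        =ᶠ[𝓝 t] fun s => (Real.log b - Real.log s) ^ (1 - α s) * ∫ v in Ioo (0 : ℝ) 1,
          v ^ (-α s) * (x (Real.exp ((1 - v) * Real.log s + v * Real.log b)) - x b) := by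
      filter_upwards [Ioo_mem_nhds ht0 ht.2] with s hs
      exact aux_subst x s b (α s) hs.1 hs.2
    refine DifferentiableAt.congr_of_eventuallyEq ?_ hev
    refine DifferentiableAt.mul ?_ ?_
    · refine DifferentiableAt.rpow (hlog.const_sub _) (hαd'.const_sub _) ?_
      exact (sub_pos.2 (Real.log_lt_log ht0 ht.2)).ne'
    · have h := aux_diff (fun u => x (Real.exp u)) (hx.comp Real.contDiff_exp) (Real.log b) (x b)
        (Real.log t) (α t) hαt.2
      exact DifferentiableAt.comp t (f := fun s => (Real.log s, α s)) h (hlog.prodMk hαd')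
  have hpos : 0 < 1 - α t := by linarith [hαt.2]
  have hG0 : Real.Gamma (1 - α t) ≠ 0 := (Real.Gamma_pos_of_pos hpos).ne'
  have hG : DifferentiableAt ℝ Real.Gamma (1 - α t) := by
    apply Real.differentiableAt_Gamma
    intro m h
    have : (0 : ℝ) ≤ m := Nat.cast_nonneg m
    linarith
  have hGα : HasDerivAt (fun s => Real.Gamma (1 - α s)) (deriv Real.Gamma (1 - α t) * -deriv α t) t :=
    HasDerivAt.comp (h₂ := Real.Gamma) t hG.hasDerivAt (hαd'.hasDerivAt.const_sub 1)
  have hprod := ((hGα.inv hG0).mul hI.hasDerivAt).deriv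
  unfold CHD3r CHD2r digamma
  simp only [one_div]
  rw [show deriv (fun s : ℝ => (Real.Gamma (1 - α s))⁻¹ *
    ∫ τ in s..b, (Real.log (τ / s)) ^ (-(α s)) * (x τ - x b) / τ) t = _ from hprod]
  simp only [Pi.inv_apply]
  field_simp
  ring
end
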